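/- arXiv:1305.7208 — 3 statements merged into one kernel-verified Lean document; each statement's English description precedes it below -/
import Mathlib

section
/- Fix an integer n ≥ 1 and β ∈ (0,2]. The equation β·cot(nθ) + (2−β)·cot(θ/2) = 0 has a unique solution θ* in the interval [((2n−1)/(2n))·π, π), and the spectral norm of the n×n lower-triangular Toeplitz matrix M_n(β) equals ‖M_n(β)‖∞ = (1/2)·√( (β−2)² + β²/cot²(θ*/2) ). -/
open scoped BigOperators Real

/-- The spectral norm (largest singular value) of a real matrix, i.e. the
operator norm induced by the Euclidean norm. -/
noncomputable def specNormR {n : ℕ} (A : Matrix (Fin n) (Fin n) ℝ) : ℝ :=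
  ‖LinearMap.toContinuousLinearMap (Matrix.toEuclideanLin A)‖

/-- The lower-triangular Toeplitz matrix with `1` on the diagonal and `β`
strictly below the diagonal. -/
def toeplitzM (n : ℕ) (β : ℝ) : Matrix (Fin n) (Fin n) ℝ :=
  Matrix.of fun i j => if i < j then 0 else if i = j then 1 else β

/-- If the quadratic form of `Aᵀ A` is bounded by `K ^ 2`, with equality at a nonzero vector,
then the spectral norm of `A` is `K`. -/
theorem specNormR_eq_of_isGreatest {n : ℕ} (A : Matrix (Fin n) (Fin n) ℝ) {K : ℝ} (hK : 0 ≤ K)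
    (hle : ∀ x : Fin n → ℝ, ∑ i, (A.mulVec x i) ^ 2 ≤ K ^ 2 * ∑ i, x i ^ 2)
    (x₀ : Fin n → ℝ) (hx₀ : x₀ ≠ 0)
    (heq : ∑ i, (A.mulVec x₀ i) ^ 2 = K ^ 2 * ∑ i, x₀ i ^ 2) :
    specNormR A = K := by
  have hnorm : ∀ x : EuclideanSpace ℝ (Fin n), ‖x‖ ^ 2 = ∑ i, x i ^ 2 := fun x => by
    simp [EuclideanSpace.norm_sq_eq]
  have happ : ∀ x : EuclideanSpace ℝ (Fin n),
      ‖(LinearMap.toContinuousLinearMap (Matrix.toEuclideanLin A)) x‖ ^ 2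
        = ∑ i, (A.mulVec x.ofLp i) ^ 2 := fun x => by
    rw [hnorm]; simp [Matrix.toLpLin_apply]
  apply le_antisymm
  · refine ContinuousLinearMap.opNorm_le_bound _ hK fun x => ?_
    refine abs_le_of_sq_le_sq' ?_ (by positivity) |>.2
    rw [happ, mul_pow, hnorm]
    exact hle _
  · have hpos : 0 < ‖WithLp.toLp 2 x₀‖ := by
      rw [norm_pos_iff]
      simpa using hx₀
    refine le_of_mul_le_mul_right ?_ hpos
    refine le_trans ?_ (ContinuousLinearMap.le_opNorm _ _)
    refine abs_le_of_sq_le_sq' ?_ (by positivity) |>.2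
    rw [happ, mul_pow, hnorm]
    exact heq.ge

theorem toeplitzM_mulVec (n : ℕ) (β : ℝ) (x : ℕ → ℝ) (i : Fin n) :
    (toeplitzM n β).mulVec (fun j => x j) i = x i + β * ∑ j ∈ Finset.range i, x j := by
  have h : ∀ j : Fin n, toeplitzM n β i j * x j =
      (if (j : ℕ) = i then x j else 0) + if (j : ℕ) < i then β * x j else 0 := fun j => by
    simp only [toeplitzM, Matrix.of_apply, Fin.lt_def, Fin.ext_iff]
    rcases lt_trichotomy (i : ℕ) j with h | h | h
    · simp only [h, h.ne', h.not_gt, if_true, if_false, zero_mul, add_zero]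
    · simp [h]
    · simp only [h, h.ne, h.ne', h.not_gt, if_true, if_false, zero_add]
  simp only [Matrix.mulVec, dotProduct, h]
  rw [Fin.sum_univ_eq_sum_range
    (fun j => (if j = (i : ℕ) then x j else 0) + if j < (i : ℕ) then β * x j else 0) n,
    Finset.sum_add_distrib, Finset.sum_ite_eq', if_pos (Finset.mem_range.2 i.2),
    ← Finset.sum_filter, Finset.mul_sum]
  congr 2
  ext j
  simp only [Finset.mem_filter, Finset.mem_range]
  have := i.2
  omega

section QuadraticForm

variable {β l a c : ℝ} {v : ℕ → ℝ} {n : ℕ}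

/-- Discrete Picone inequality for the form `l * ‖x‖ ^ 2 - ‖M x‖ ^ 2`, with `M` the Toeplitz matrix,
relative to a positive solution `v` of the associated three-term recurrence. -/
theorem picone_le_sum (hc : c = l + β - 1) (hc0 : 0 ≤ c) (ha : 2 * l - 1 - (β - 1) ^ 2 = c * a)
    (hrec : ∀ k, v (k + 2) = a * v (k + 1) - v k) (hv0 : v 0 = 0)
    (hpos : ∀ k, 1 ≤ k → k ≤ n → 0 < v k) (x : ℕ → ℝ) (k : ℕ) (hk : k ≤ n) :
    (c * v (k + 1) / v k - (l - (β - 1) ^ 2)) * (∑ j ∈ Finset.range k, x j) ^ 2 ≤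
      ∑ i ∈ Finset.range k, (l * x i ^ 2 - (x i + β * ∑ j ∈ Finset.range i, x j) ^ 2) := by
  induction k with
  | zero => simp
  | succ k ih =>
    have ih := ih (by omega)
    rw [Finset.sum_range_succ, Finset.sum_range_succ _ k]
    have hp := hpos (k + 1) (by omega) hk
    rcases Nat.eq_zero_or_pos k with rfl | hk0
    · have h2 : v (0 + 1 + 1) = a * v (0 + 1) := by rw [hrec 0, hv0, sub_zero]
      rw [h2, ← mul_assoc, mul_div_cancel_right₀ _ hp.ne', ← ha]
      simp
      nlinarith
    · have hq := hpos k hk0 (by omega)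
      set y := ∑ j ∈ Finset.range k, x j
      rw [hrec k]
      have key : l * x k ^ 2 - (x k + β * y) ^ 2
          + (c * v (k + 1) / v k - (l - (β - 1) ^ 2)) * y ^ 2
          - (c * (a * v (k + 1) - v k) / v (k + 1) - (l - (β - 1) ^ 2)) * (y + x k) ^ 2
          = c * (v k * v (k + 1)) * ((y + x k) / v (k + 1) - y / v k) ^ 2 := by
        have e : c * (a * v (k + 1) - v k) / v (k + 1) = c * a - c * v k / v (k + 1) := by
          field_simp
        rw [e, ← ha]
        field_simp
        rw [hc]
        ring
      have : 0 ≤ c * (v k * v (k + 1)) * ((y + x k) / v (k + 1) - y / v k) ^ 2 := by positivity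
      linarith

theorem sum_eq_of_recurrence (hc : c = l + β - 1) (ha : 2 * l - 1 - (β - 1) ^ 2 = c * a)
    (hrec : ∀ k, v (k + 2) = a * v (k + 1) - v k) (hv0 : v 0 = 0) (k : ℕ) :
    ∑ i ∈ Finset.range k, (l * (v (i + 1) - v i) ^ 2
        - ((v (i + 1) - v i) + β * ∑ j ∈ Finset.range i, (v (j + 1) - v j)) ^ 2) =
      v k * (c * v (k + 1) - (l - (β - 1) ^ 2) * v k) := by
  simp only [Finset.sum_range_sub, hv0, sub_zero]
  induction k with
  | zero => simp [hv0]
  | succ k ih =>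
    rw [Finset.sum_range_succ, ih, hrec k]
    linear_combination v (k + 1) ^ 2 * ha + 2 * v k * v (k + 1) * hc

theorem specNormR_toeplitzM_of_recurrence (hn : 1 ≤ n) (hl : 0 ≤ l)
    (hc : c = l + β - 1) (hc0 : 0 ≤ c) (ha : 2 * l - 1 - (β - 1) ^ 2 = c * a)
    (hrec : ∀ k, v (k + 2) = a * v (k + 1) - v k) (hv0 : v 0 = 0)
    (hpos : ∀ k, 1 ≤ k → k ≤ n → 0 < v k) (hend : c * v (n + 1) = (l - (β - 1) ^ 2) * v n) :
    specNormR (toeplitzM n β) = √l := by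
  refine specNormR_eq_of_isGreatest _ (Real.sqrt_nonneg l) (fun x => ?_)
    (fun j => v (j + 1) - v j) (fun h => ?_) ?_
  · obtain ⟨z, rfl⟩ : ∃ z : ℕ → ℝ, x = fun j : Fin n => z j :=
      ⟨fun j => if h : j < n then x ⟨j, h⟩ else 0, by ext j; simp⟩
    have h := picone_le_sum hc hc0 ha hrec hv0 hpos z n le_rfl
    rw [hend, mul_div_cancel_right₀ _ (hpos n hn le_rfl).ne', sub_self, zero_mul,
      Finset.sum_sub_distrib, ← Finset.mul_sum, sub_nonneg] at h
    simp only [toeplitzM_mulVec, Real.sq_sqrt hl]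
    rw [Fin.sum_univ_eq_sum_range (fun i => (z i + β * ∑ j ∈ Finset.range i, z j) ^ 2),
      Fin.sum_univ_eq_sum_range (fun i => z i ^ 2)]
    exact h
  · have h1 := congrFun h ⟨0, hn⟩
    have h2 := hpos 1 le_rfl hn
    simp [hv0] at h1
    exact h2.ne' h1
  · have h := sum_eq_of_recurrence hc ha hrec hv0 n
    rw [hend, sub_self, mul_zero, Finset.sum_sub_distrib, ← Finset.mul_sum, sub_eq_zero] at h
    have hM := toeplitzM_mulVec n β (fun j => v (j + 1) - v j)
    simp only [hM, Real.sq_sqrt hl]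
    rw [Fin.sum_univ_eq_sum_range
        (fun i => (v (i + 1) - v i + β * ∑ j ∈ Finset.range i, (v (j + 1) - v j)) ^ 2),
      Fin.sum_univ_eq_sum_range (fun i => (v (i + 1) - v i) ^ 2)]
    exact h.symm

end QuadraticForm

section Angle

variable {n : ℕ} {β φ : ℝ}

theorem angle_bounds (hn : 1 ≤ n) (hφ : φ ∈ Set.Ioc 0 (π / (2 * n))) :
    0 < n * φ ∧ n * φ ≤ π / 2 ∧ φ ≤ n * φ := by
  have hn' : (1 : ℝ) ≤ n := by exact_mod_cast hn
  obtain ⟨h0, h1⟩ := hφ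
  refine ⟨by positivity, ?_, by nlinarith⟩
  rw [le_div_iff₀ (by positivity)] at h1
  linarith

theorem cot_equation_iff (hn : 1 ≤ n) (hφ : φ ∈ Set.Ioc 0 (π / (2 * n))) :
    β * Real.cot (n * (π - φ)) + (2 - β) * Real.cot ((π - φ) / 2) = 0 ↔
      β * (Real.cos (n * φ) * Real.cos (φ / 2)) =
        (2 - β) * (Real.sin (n * φ) * Real.sin (φ / 2)) := by
  obtain ⟨h1, h2, h3⟩ := angle_bounds hn hφ
  have h0 := hφ.1
  have hs : 0 < Real.sin (n * φ) := Real.sin_pos_of_pos_of_lt_pi h1 (by linarith [Real.pi_pos])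
  have hC : 0 < Real.cos (φ / 2) :=
    Real.cos_pos_of_mem_Ioo ⟨by linarith [Real.pi_pos], by linarith [Real.pi_pos]⟩
  have e1 : Real.cot (n * (π - φ)) = -(Real.cos (n * φ) / Real.sin (n * φ)) := by
    have hk : ((-1 : ℝ) ^ n) ≠ 0 := pow_ne_zero _ (by norm_num)
    rw [Real.cot_eq_cos_div_sin, mul_sub, Real.cos_nat_mul_pi_sub, Real.sin_nat_mul_pi_sub]
    field_simp
  have e2 : Real.cot ((π - φ) / 2) = Real.sin (φ / 2) / Real.cos (φ / 2) := by
    rw [Real.cot_eq_cos_div_sin, sub_div, Real.cos_pi_div_two_sub, Real.sin_pi_div_two_sub]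
  rw [e1, e2]
  field_simp
  constructor <;> intro h <;> linarith

theorem exists_angle (hn : 1 ≤ n) (hβ : β ∈ Set.Ioc (0 : ℝ) 2) :
    ∃ φ ∈ Set.Ioc 0 (π / (2 * n)), β * (Real.cos (n * φ) * Real.cos (φ / 2)) =
        (2 - β) * (Real.sin (n * φ) * Real.sin (φ / 2)) := by
  have hn' : (1 : ℝ) ≤ n := by exact_mod_cast hn
  have hb : 0 < π / (2 * n) := by positivity
  set h : ℝ → ℝ := fun φ => β * (Real.cos (n * φ) * Real.cos (φ / 2)) -
        (2 - β) * (Real.sin (n * φ) * Real.sin (φ / 2)) with hh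
  have hcont : ContinuousOn h (Set.Icc 0 (π / (2 * n))) := by fun_prop
  have hend : h (π / (2 * n)) ≤ 0 := by
    have e : (n : ℝ) * (π / (2 * n)) = π / 2 := by field_simp
    obtain ⟨h1, h2, h3⟩ := angle_bounds hn (Set.right_mem_Ioc.2 hb)
    have hS : 0 ≤ Real.sin (π / (2 * n) / 2) :=
      Real.sin_nonneg_of_nonneg_of_le_pi (by positivity) (by linarith)
    simp only [hh, e, Real.cos_pi_div_two, Real.sin_pi_div_two]
    nlinarith [hβ.2]
  obtain ⟨φ, hφ, hz⟩ := intermediate_value_Icc' hb.le hcont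
    (⟨hend, by simp [hh, hβ.1.le]⟩ : (0 : ℝ) ∈ Set.Icc (h (π / (2 * n))) (h 0))
  refine ⟨φ, ⟨lt_of_le_of_ne hφ.1 ?_, hφ.2⟩, sub_eq_zero.1 hz⟩
  rintro rfl
  simp [hh] at hz
  exact hβ.1.ne' hz

theorem angle_le_of_equation (hn : 1 ≤ n) (hβ : β ∈ Set.Ioc (0 : ℝ) 2) {φ₁ φ₂ : ℝ}
    (hφ₁ : φ₁ ∈ Set.Ioc 0 (π / (2 * n))) (hφ₂ : φ₂ ∈ Set.Ioc 0 (π / (2 * n)))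
    (h₁ : β * (Real.cos (n * φ₁) * Real.cos (φ₁ / 2)) =
        (2 - β) * (Real.sin (n * φ₁) * Real.sin (φ₁ / 2)))
    (h₂ : β * (Real.cos (n * φ₂) * Real.cos (φ₂ / 2)) =
        (2 - β) * (Real.sin (n * φ₂) * Real.sin (φ₂ / 2))) : φ₂ ≤ φ₁ := by
  by_contra! hlt
  obtain ⟨a1, a2, a3⟩ := angle_bounds hn hφ₁
  obtain ⟨b1, b2, b3⟩ := angle_bounds hn hφ₂
  have p1 := hφ₁.1
  have p2 := hφ₂.1
  have hpi := Real.pi_pos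
  have hn' : (1 : ℝ) ≤ n := by exact_mod_cast hn
  have hnlt : n * φ₁ < n * φ₂ := by nlinarith
  have hcos : Real.cos (n * φ₂) * Real.cos (φ₂ / 2) < Real.cos (n * φ₁) * Real.cos (φ₁ / 2) :=
    mul_lt_mul'' (Real.cos_lt_cos_of_nonneg_of_le_pi a1.le (by linarith) hnlt)
      (Real.cos_lt_cos_of_nonneg_of_le_pi (by linarith) (by linarith) (by linarith))
      (Real.cos_nonneg_of_mem_Icc ⟨by linarith, by linarith⟩)
      (Real.cos_nonneg_of_mem_Icc ⟨by linarith, by linarith⟩)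
  have hsin : Real.sin (n * φ₁) * Real.sin (φ₁ / 2) < Real.sin (n * φ₂) * Real.sin (φ₂ / 2) :=
    mul_lt_mul'' (Real.sin_lt_sin_of_lt_of_le_pi_div_two (by linarith) (by linarith) hnlt)
      (Real.sin_lt_sin_of_lt_of_le_pi_div_two (by linarith) (by linarith) (by linarith))
      (Real.sin_nonneg_of_nonneg_of_le_pi (by linarith) (by linarith))
      (Real.sin_nonneg_of_nonneg_of_le_pi (by linarith) (by linarith))
  have c1 := mul_lt_mul_of_pos_left hcos hβ.1
  have c2 := mul_le_mul_of_nonneg_left hsin.le (sub_nonneg.2 hβ.2)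
  linarith

theorem specNormR_toeplitzM_of_angle (hn : 1 ≤ n)
    (hφ : φ ∈ Set.Ioc 0 (π / (2 * n)))
    (h : β * (Real.cos (n * φ) * Real.cos (φ / 2)) =
        (2 - β) * (Real.sin (n * φ) * Real.sin (φ / 2))) :
    specNormR (toeplitzM n β) =
      (1 / 2) * √((β - 2) ^ 2 + β ^ 2 / Real.cot ((π - φ) / 2) ^ 2) := by
  obtain ⟨h1, h2, h3⟩ := angle_bounds hn hφ
  have h0 := hφ.1
  have hpi := Real.pi_pos
  set S := Real.sin (φ / 2) with hSdef
  set C := Real.cos (φ / 2) with hCdef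
  have hS : 0 < S := Real.sin_pos_of_pos_of_lt_pi (by linarith) (by linarith)
  have hC : 0 < C := Real.cos_pos_of_mem_Ioo ⟨by linarith, by linarith⟩
  have hSC : C ^ 2 = 1 - S ^ 2 := Real.cos_sq' _
  have hsinφ : Real.sin φ = 2 * S * C := by
    rw [hSdef, hCdef, ← Real.sin_two_mul]; ring_nf
  have hcosφ : Real.cos φ = 1 - 2 * S ^ 2 := by
    have := Real.cos_two_mul (φ / 2)
    rw [mul_div_cancel₀ φ two_ne_zero, ← hCdef] at this
    linarith
  have hcot : Real.cot ((π - φ) / 2) = S / C := by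
    rw [Real.cot_eq_cos_div_sin, sub_div, Real.cos_pi_div_two_sub, Real.sin_pi_div_two_sub]
  have hquad : (β - 2) ^ 2 + β ^ 2 / (S / C) ^ 2 = 2 ^ 2 * (1 - β + β ^ 2 / (4 * S ^ 2)) := by
    field_simp
    rw [hSC]
    ring
  have hl : 0 ≤ 1 - β + β ^ 2 / (4 * S ^ 2) := by
    have : 0 ≤ (β - 2) ^ 2 + β ^ 2 / (S / C) ^ 2 := by positivity
    linarith
  rw [hcot, hquad, Real.sqrt_mul (by norm_num), Real.sqrt_sq (by norm_num), ← mul_assoc,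
    one_div_mul_cancel two_ne_zero, one_mul]
  refine specNormR_toeplitzM_of_recurrence (c := β ^ 2 / (4 * S ^ 2)) (a := 2 * Real.cos φ)
    (v := fun k => Real.sin (k * φ)) hn hl (by ring) (by positivity) ?_ (fun k => ?_) (by simp)
    (fun k hk hkn => ?_) ?_
  · rw [hcosφ]
    field_simp
    ring
  · have e1 : ((k + 2 : ℕ) : ℝ) * φ = ((k + 1 : ℕ) : ℝ) * φ + φ := by push_cast; ring
    have e2 : (k : ℝ) * φ = ((k + 1 : ℕ) : ℝ) * φ - φ := by push_cast; ring
    simp only [e1]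
    rw [e2, Real.sin_add, Real.sin_sub]
    ring
  · have hk' : (1 : ℝ) ≤ k := by exact_mod_cast hk
    have hkn' : (k : ℝ) ≤ n := by exact_mod_cast hkn
    exact Real.sin_pos_of_pos_of_lt_pi (by positivity) (by nlinarith)
  · have e1 : ((n + 1 : ℕ) : ℝ) * φ = n * φ + φ := by push_cast; ring
    simp only [e1]
    rw [Real.sin_add, hsinφ, hcosφ]
    field_simp
    linear_combination 2 * S * β * h

end Angle

theorem norm_toeplitz (n : ℕ) (hn : 1 ≤ n) (β : ℝ) (hβ : β ∈ Set.Ioc (0 : ℝ) 2) :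
    ∃ θ : ℝ, θ ∈ Set.Ico (((2 * n - 1) / (2 * n)) * π) π ∧
      β * Real.cot (n * θ) + (2 - β) * Real.cot (θ / 2) = 0 ∧
      (∀ θ' ∈ Set.Ico (((2 * n - 1) / (2 * n)) * π) π,
        β * Real.cot (n * θ') + (2 - β) * Real.cot (θ' / 2) = 0 → θ' = θ) ∧
      specNormR (toeplitzM n β) =
        (1 / 2) * Real.sqrt ((β - 2) ^ 2 + β ^ 2 / Real.cot (θ / 2) ^ 2) := by
  have hn' : (1 : ℝ) ≤ n := by exact_mod_cast hn
  have hleft : ((2 * n - 1) / (2 * n)) * π = π - π / (2 * n) := by field_simp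
  obtain ⟨φ, hφ, h⟩ := exists_angle hn hβ
  refine ⟨π - φ, ?_, (cot_equation_iff hn hφ).2 h, fun θ' hθ' h' => ?_,
    specNormR_toeplitzM_of_angle hn hφ h⟩
  · rw [hleft]
    exact ⟨by linarith [hφ.2], by linarith [hφ.1]⟩
  · rw [hleft] at hθ'
    have hψ : π - θ' ∈ Set.Ioc 0 (π / (2 * n)) := ⟨by linarith [hθ'.2], by linarith [hθ'.1]⟩
    rw [← sub_sub_cancel π θ', cot_equation_iff hn hψ] at h'
    linarith [angle_le_of_equation hn hβ hφ hψ h h', angle_le_of_equation hn hβ hψ hφ h' h]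
end

section
/- For every integer n ≥ 1, the spectral norm of the n×n lower-triangular Toeplitz matrix M_n(2) (with ones on the diagonal and all entries below the diagonal equal to 2) equals cot(π/(4n)). -/
open scoped BigOperators Real

/-- The sum of the entries of `x` with index below `k`. -/
noncomputable def partialSum {n : ℕ} (x : Fin n → ℝ) (k : ℕ) : ℝ :=
  ∑ j : Fin n, if (j : ℕ) < k then x j else 0

theorem partialSum_zero {n : ℕ} (x : Fin n → ℝ) : partialSum x 0 = 0 := by
  simp [partialSum]

theorem partialSum_succ {n : ℕ} (x : Fin n → ℝ) (i : Fin n) :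
    partialSum x (i + 1) = partialSum x i + x i := by
  have h : x i = ∑ j : Fin n, if j = i then x j else 0 := by simp
  conv_rhs => rw [h]
  rw [partialSum, partialSum, ← Finset.sum_add_distrib]
  refine Finset.sum_congr rfl fun j _ => ?_
  rcases lt_trichotomy (j : ℕ) i with hj | hj | hj
  · simp [hj, Fin.ext_iff, hj.ne, Nat.lt_succ_of_lt hj]
  · simp [hj, Fin.ext_iff]
  · simp [Fin.ext_iff, hj.ne', not_lt.2 hj.le, not_lt.2 (Nat.succ_le_of_lt hj)]

theorem partialSum_sub {n : ℕ} (s : ℕ → ℝ) (hs : s 0 = 0) {k : ℕ} (hk : k ≤ n) :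
    partialSum (fun i : Fin n => s (i + 1) - s i) k = s k := by
  induction k with
  | zero => rw [partialSum_zero, hs]
  | succ k ih =>
    have := partialSum_succ (fun i : Fin n => s (i + 1) - s i) ⟨k, hk⟩
    simp only at this
    rw [this, ih (Nat.le_of_succ_le hk)]
    ring

theorem toeplitzM_two_mulVec {n : ℕ} (x : Fin n → ℝ) (i : Fin n) :
    (toeplitzM n 2).mulVec x i = partialSum x i + partialSum x (i + 1) := by
  rw [Matrix.mulVec, dotProduct, partialSum, partialSum, ← Finset.sum_add_distrib]
  refine Finset.sum_congr rfl fun j _ => ?_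
  rcases lt_trichotomy (j : ℕ) i with hj | hj | hj
  · have h₁ : ¬ i < j := not_lt.2 (Fin.le_def.2 hj.le)
    simp [toeplitzM, hj, h₁, Fin.ext_iff, hj.ne', Nat.lt_succ_of_lt hj]
    ring
  · simp [toeplitzM, Fin.ext hj]
  · have h₁ : i < j := hj
    simp [toeplitzM, h₁, not_lt.2 h₁.le, not_lt.2 (Nat.succ_le_of_lt hj)]

theorem norm_sq_eq_sum_partialSum {n : ℕ} (x : EuclideanSpace ℝ (Fin n)) :
    ‖x‖ ^ 2 = ∑ i ∈ Finset.range n, (partialSum x (i + 1) - partialSum x i) ^ 2 := by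
  rw [EuclideanSpace.real_norm_sq_eq,
    ← Fin.sum_univ_eq_sum_range (fun i => (partialSum x (i + 1) - partialSum x i) ^ 2)]
  simp [partialSum_succ]

theorem norm_sq_toEuclideanLin_toeplitzM_two {n : ℕ} (x : EuclideanSpace ℝ (Fin n)) :
    ‖Matrix.toEuclideanLin (toeplitzM n 2) x‖ ^ 2 =
      ∑ i ∈ Finset.range n, (partialSum x i + partialSum x (i + 1)) ^ 2 := by
  rw [EuclideanSpace.real_norm_sq_eq,
    ← Fin.sum_univ_eq_sum_range (fun i => (partialSum x i + partialSum x (i + 1)) ^ 2)]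
  refine Finset.sum_congr rfl fun i _ => ?_
  rw [← toeplitzM_two_mulVec]
  rfl

theorem cos_sq_mul_sub_sin_sq_mul (θ a b : ℝ) :
    Real.cos θ ^ 2 * (b - a) ^ 2 - Real.sin θ ^ 2 * (a + b) ^ 2 =
      Real.cos (2 * θ) * (a ^ 2 + b ^ 2) - 2 * a * b := by
  rw [Real.cos_two_mul, Real.sin_sq]
  ring

/-- A discrete Wirtinger inequality for sequences starting at `0`. -/
theorem sin_mul_cot_mul_sq_le_sum {φ : ℝ} {n : ℕ} (hφ : 0 < φ) (hn : n * φ < π)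
    (S : ℕ → ℝ) (hS : S 0 = 0) {m : ℕ} (hm : m ≤ n) :
    Real.sin φ * (Real.cos (m * φ) / Real.sin (m * φ)) * S m ^ 2 ≤
      ∑ i ∈ Finset.range m,
        (Real.cos φ * (S i ^ 2 + S (i + 1) ^ 2) - 2 * S i * S (i + 1)) := by
  have hpos : ∀ k : ℕ, 0 < k → k ≤ n → 0 < Real.sin (k * φ) := fun k hk hkn =>
    Real.sin_pos_of_pos_of_lt_pi (by positivity)
      (lt_of_le_of_lt (by gcongr) hn)
  induction m with
  | zero => simp
  | succ m ih =>
    rw [Finset.sum_range_succ]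
    rcases Nat.eq_zero_or_pos m with rfl | hm0
    · have h1 := hpos 1 one_pos hm
      simp only [Nat.cast_one, one_mul] at h1
      simp only [zero_add, Nat.cast_one, one_mul, hS, Finset.range_zero, Finset.sum_empty]
      rw [mul_div_cancel₀ _ h1.ne']
      simp
    · have ha := hpos m hm0 (Nat.le_of_succ_le hm)
      have hb := hpos (m + 1) m.succ_pos hm
      refine le_trans ?_ (add_le_add_left (ih (Nat.le_of_succ_le hm)) _)
      have e : ((m + 1 : ℕ) : ℝ) * φ = m * φ + φ := by push_cast; ring
      rw [e] at hb ⊢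
      have hsb := Real.sin_add (m * φ) φ
      have hcb := Real.cos_add (m * φ) φ
      have hsc := Real.sin_sq_add_cos_sq φ
      set s := Real.sin (m * φ)
      set c := Real.cos (m * φ)
      set s' := Real.sin (m * φ + φ)
      set c' := Real.cos (m * φ + φ)
      set p := Real.sin φ
      set q := Real.cos φ
      have h1 : q + p * (c / s) = s' / s := by
        field_simp; rw [hsb]; ring
      have h2 : q - p * (c' / s') = s / s' := by
        field_simp; rw [hsb, hcb]; linear_combination s * hsc
      have h3 : 0 ≤ (s' * S m - s * S (m + 1)) ^ 2 / (s * s') := by positivity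
      have h4 : (s' * S m - s * S (m + 1)) ^ 2 / (s * s') =
          s' / s * S m ^ 2 - 2 * S m * S (m + 1) + s / s' * S (m + 1) ^ 2 := by
        field_simp
        ring
      rw [h4, ← h1, ← h2] at h3
      linarith

theorem sum_sin_eq_sin_mul_cos_mul_sin (φ : ℝ) (m : ℕ) :
    ∑ i ∈ Finset.range m,
        (Real.cos φ * (Real.sin (i * φ) ^ 2 + Real.sin ((i + 1 : ℕ) * φ) ^ 2) -
          2 * Real.sin (i * φ) * Real.sin ((i + 1 : ℕ) * φ)) =
      Real.sin φ * Real.cos (m * φ) * Real.sin (m * φ) := by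
  induction m with
  | zero => simp
  | succ m ih =>
    have e : ((m + 1 : ℕ) : ℝ) * φ = m * φ + φ := by push_cast; ring
    rw [Finset.sum_range_succ, ih, e, Real.sin_add, Real.cos_add]
    have hsc := Real.sin_sq_add_cos_sq φ
    set s := Real.sin (m * φ)
    set c := Real.cos (m * φ)
    set p := Real.sin φ
    set q := Real.cos φ
    linear_combination (q * s ^ 2 + p * s * c) * hsc

theorem norm_toeplitz_two (n : ℕ) (hn : 1 ≤ n) :
    specNormR (toeplitzM n 2) = Real.cot (π / (4 * n)) := by
  have hn' : (1 : ℝ) ≤ n := by exact_mod_cast hn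
  have hπ := Real.pi_pos
  set θ : ℝ := π / (4 * n) with hθ
  have hθ0 : 0 < θ := by positivity
  have hnθ : n * (2 * θ) = π / 2 := by rw [hθ]; field_simp; norm_num
  have hθ1 : 2 * θ ≤ π / 2 := by nlinarith
  have hsin : 0 < Real.sin θ := Real.sin_pos_of_pos_of_lt_pi hθ0 (by linarith)
  have hcos : 0 < Real.cos θ := Real.cos_pos_of_mem_Ioo ⟨by linarith, by linarith⟩
  have key : ∀ x : EuclideanSpace ℝ (Fin n),
      Real.cos θ ^ 2 * ‖x‖ ^ 2 -
        Real.sin θ ^ 2 * ‖Matrix.toEuclideanLin (toeplitzM n 2) x‖ ^ 2 =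
      ∑ i ∈ Finset.range n, (Real.cos (2 * θ) *
        (partialSum x i ^ 2 + partialSum x (i + 1) ^ 2) -
          2 * partialSum x i * partialSum x (i + 1)) := fun x => by
    rw [norm_sq_eq_sum_partialSum, norm_sq_toEuclideanLin_toeplitzM_two, Finset.mul_sum,
      Finset.mul_sum, ← Finset.sum_sub_distrib]
    exact Finset.sum_congr rfl fun i _ => cos_sq_mul_sub_sin_sq_mul _ _ _
  rw [Real.cot_eq_cos_div_sin, specNormR]
  apply le_antisymm
  · refine ContinuousLinearMap.opNorm_le_bound _ (by positivity) fun x => ?_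
    have h := sin_mul_cot_mul_sq_le_sum (φ := 2 * θ) (by positivity) (by rw [hnθ]; linarith)
      (partialSum x) (partialSum_zero x) le_rfl
    rw [hnθ, Real.cos_pi_div_two, ← key, zero_div, mul_zero, zero_mul] at h
    rw [LinearMap.coe_toContinuousLinearMap', div_mul_eq_mul_div, le_div_iff₀ hsin, mul_comm]
    refine le_of_sq_le_sq ?_ (by positivity)
    rw [mul_pow, mul_pow]
    linarith
  · let s : ℕ → ℝ := fun k => Real.sin (k * (2 * θ))
    let x : EuclideanSpace ℝ (Fin n) := WithLp.toLp 2 fun i => s (i + 1) - s i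
    have hps : ∀ k ≤ n, partialSum x k = s k := fun k hk =>
      partialSum_sub s (by simp [s]) hk
    have hx : 0 < ‖x‖ := by
      refine norm_pos_iff.2 fun h0 => ?_
      have h := hps n le_rfl
      simp [h0, partialSum, s, hnθ] at h
    have h := key x
    rw [Finset.sum_congr rfl (g := fun i : ℕ => Real.cos (2 * θ) *
        (s i ^ 2 + s (i + 1) ^ 2) - 2 * s i * s (i + 1)) fun i hi => by
          rw [hps i (Finset.mem_range.1 hi).le, hps (i + 1) (Finset.mem_range.1 hi)],
      sum_sin_eq_sin_mul_cos_mul_sin, hnθ, Real.cos_pi_div_two] at h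
    have hle := ContinuousLinearMap.le_opNorm
      (LinearMap.toContinuousLinearMap (Matrix.toEuclideanLin (toeplitzM n 2))) x
    refine le_of_mul_le_mul_right (le_trans ?_ hle) hx
    rw [LinearMap.coe_toContinuousLinearMap', div_mul_eq_mul_div, div_le_iff₀ hsin,
      mul_comm _ (Real.sin θ)]
    refine le_of_sq_le_sq ?_ (by positivity)
    rw [mul_pow, mul_pow]
    linarith
end

section
/- For every integer n ≥ 1, the spectral norm of the n×n lower-triangular Toeplitz matrix M_n(1) (with ones on the diagonal and all entries below the diagonal equal to 1) equals 1/(2·sin(π/(4n+2))). -/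
open scoped BigOperators Real

open Finset in
/-- Schur test: for `A` nonnegative, vectors `x > 0` and `y` with `A x = s y` and `Aᵀ y = s x` bound the
norm of `A v` by `s` times that of `v`. -/
lemma sum_sq_mulVec_le {ι κ : Type*} [Fintype ι] [Fintype κ] (A : Matrix ι κ ℝ)
    (hA : ∀ i j, 0 ≤ A i j) (x : κ → ℝ) (y : ι → ℝ) (hx : ∀ j, 0 < x j) (s : ℝ)
    (hAx : ∀ i, ∑ j, A i j * x j = s * y i) (hAy : ∀ j, ∑ i, A i j * y i = s * x j)
    (v : κ → ℝ) : ∑ i, (A.mulVec v i) ^ 2 ≤ s ^ 2 * ∑ j, v j ^ 2 := by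
  have cauchy (i : ι) :
      (A.mulVec v i) ^ 2 ≤ (∑ j, A i j * x j) * ∑ j, A i j * (v j ^ 2 / x j) := by
    refine sum_sq_le_sum_mul_sum_of_sq_le_mul univ
      (fun j _ => mul_nonneg (hA i j) (hx j).le)
      (fun j _ => mul_nonneg (hA i j) (div_nonneg (sq_nonneg _) (hx j).le)) fun j _ => ?_
    have := (hx j).ne'
    exact le_of_eq (by field_simp)
  calc ∑ i, (A.mulVec v i) ^ 2
      ≤ ∑ i, ∑ j, s * (v j ^ 2 / x j) * (A i j * y i) := by
        refine sum_le_sum fun i _ => (cauchy i).trans_eq ?_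
        rw [hAx, mul_sum]
        exact sum_congr rfl fun j _ => by ring
    _ = ∑ j, s ^ 2 * v j ^ 2 := by
        rw [sum_comm]
        refine sum_congr rfl fun j _ => ?_
        have := (hx j).ne'
        rw [← mul_sum, hAy]
        field_simp
    _ = s ^ 2 * ∑ j, v j ^ 2 := (mul_sum _ _ _).symm

open Finset in
/-- A nonnegative matrix with singular vectors `x > 0`, `y` for the singular value `s > 0` has
spectral norm `s`. -/
lemma specNormR_eq_of_pos_singular_vector {n : ℕ} (hn : 1 ≤ n)
    (A : Matrix (Fin n) (Fin n) ℝ) (hA : ∀ i j, 0 ≤ A i j) (x y : Fin n → ℝ)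
    (hx : ∀ j, 0 < x j) {s : ℝ} (hs : 0 < s)
    (hAx : ∀ i, ∑ j, A i j * x j = s * y i) (hAy : ∀ j, ∑ i, A i j * y i = s * x j) :
    specNormR A = s := by
  unfold specNormR
  apply le_antisymm
  · refine ContinuousLinearMap.opNorm_le_bound _ hs.le fun v => ?_
    rw [← abs_of_nonneg (norm_nonneg _), ← abs_of_nonneg (mul_nonneg hs.le (norm_nonneg v)),
      ← sq_le_sq, mul_pow, EuclideanSpace.real_norm_sq_eq, EuclideanSpace.real_norm_sq_eq]
    exact sum_sq_mulVec_le A hA x y hx s hAx hAy v.ofLp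
  · have hsum : ∑ i, y i ^ 2 = ∑ j, x j ^ 2 := by
      refine mul_left_cancel₀ hs.ne' ?_
      calc s * ∑ i, y i ^ 2 = ∑ i, ∑ j, A i j * x j * y i := by
            rw [mul_sum]
            exact sum_congr rfl fun i _ => by rw [← sum_mul, hAx]; ring
        _ = ∑ j, s * x j ^ 2 := by
            rw [sum_comm]
            refine sum_congr rfl fun j _ => ?_
            rw [sq, ← mul_assoc, ← hAy, sum_mul]
            exact sum_congr rfl fun i _ => by ring
        _ = s * ∑ j, x j ^ 2 := (mul_sum _ _ _).symm
    have hpos : 0 < ‖WithLp.toLp 2 x‖ := by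
      rw [norm_pos_iff]
      intro h
      have := congrArg (fun v : EuclideanSpace ℝ (Fin n) => v ⟨0, hn⟩) h
      exact (hx ⟨0, hn⟩).ne' this
    have himage : ‖LinearMap.toContinuousLinearMap (Matrix.toEuclideanLin A) (WithLp.toLp 2 x)‖
        = s * ‖WithLp.toLp 2 x‖ := by
      rw [← sq_eq_sq₀ (norm_nonneg _) (by positivity), mul_pow,
        EuclideanSpace.real_norm_sq_eq, EuclideanSpace.real_norm_sq_eq]
      change ∑ i, (∑ j, A i j * x j) ^ 2 = s ^ 2 * ∑ j, x j ^ 2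
      simp_rw [hAx, mul_pow, ← mul_sum, hsum]
    refine le_of_mul_le_mul_right ?_ hpos
    rw [← himage]
    exact ContinuousLinearMap.le_opNorm _ _

lemma sum_range_cos_odd_mul (t : ℝ) (m : ℕ) :
    (∑ j ∈ Finset.range m, Real.cos ((2 * j + 1) * t)) * (2 * Real.sin t)
      = Real.sin (2 * m * t) := by
  induction m with
  | zero => simp
  | succ m ih =>
    rw [Finset.sum_range_succ, add_mul, ih]
    have h₁ : 2 * (m : ℝ) * t = (2 * m + 1) * t - t := by ring
    have h₂ : 2 * ((m + 1 : ℕ) : ℝ) * t = (2 * m + 1) * t + t := by push_cast; ring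
    rw [h₁, h₂, Real.sin_sub, Real.sin_add]
    ring

lemma sum_Ico_sin_even_mul (t : ℝ) {k m : ℕ} (hkm : k ≤ m) :
    (∑ i ∈ Finset.Ico k m, Real.sin ((2 * i + 2) * t)) * (2 * Real.sin t)
      = Real.cos ((2 * k + 1) * t) - Real.cos ((2 * m + 1) * t) := by
  induction m, hkm using Nat.le_induction with
  | base => simp
  | succ m hkm ih =>
    rw [Finset.sum_Ico_succ_top hkm, add_mul, ih]
    have h₁ : (2 * (m : ℝ) + 1) * t = (2 * m + 2) * t - t := by ring
    have h₂ : (2 * ((m + 1 : ℕ) : ℝ) + 1) * t = (2 * m + 2) * t + t := by push_cast; ring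
    rw [h₁, h₂, Real.cos_sub, Real.cos_add]
    ring

lemma toeplitzM_one_apply {n : ℕ} (i j : Fin n) :
    toeplitzM n 1 i j = if (j : ℕ) ≤ i then 1 else 0 := by
  simp only [toeplitzM, Matrix.of_apply, ite_self, Fin.lt_def]
  split_ifs <;> first | rfl | omega

lemma sum_toeplitzM_one_row_mul {n : ℕ} (i : Fin n) (f : ℕ → ℝ) :
    ∑ j, toeplitzM n 1 i j * f j = ∑ j ∈ Finset.range (i + 1), f j := by
  simp only [toeplitzM_one_apply, ite_mul, one_mul, zero_mul]
  rw [Fin.sum_univ_eq_sum_range (fun j => if j ≤ (i : ℕ) then f j else 0), ← Finset.sum_filter]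
  congr 1
  ext j
  simp only [Finset.mem_filter, Finset.mem_range]
  omega

lemma sum_toeplitzM_one_col_mul {n : ℕ} (j : Fin n) (f : ℕ → ℝ) :
    ∑ i, toeplitzM n 1 i j * f i = ∑ i ∈ Finset.Ico (j : ℕ) n, f i := by
  simp only [toeplitzM_one_apply, ite_mul, one_mul, zero_mul]
  rw [Fin.sum_univ_eq_sum_range (fun i => if (j : ℕ) ≤ i then f i else 0), ← Finset.sum_filter]
  congr 1
  ext i
  simp only [Finset.mem_filter, Finset.mem_range, Finset.mem_Ico]
  omega

theorem norm_toeplitz_one (n : ℕ) (hn : 1 ≤ n) :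
    specNormR (toeplitzM n 1) = 1 / (2 * Real.sin (π / (4 * n + 2))) := by
  set t : ℝ := π / (4 * n + 2) with ht
  have htpos : 0 < t := by positivity
  have hquarter : (2 * (n : ℝ) + 1) * t = π / 2 := by rw [ht]; field_simp; ring
  have hsin : 0 < Real.sin t := by
    refine Real.sin_pos_of_pos_of_lt_pi htpos ?_
    nlinarith [Real.pi_pos, mul_nonneg n.cast_nonneg htpos.le]
  refine specNormR_eq_of_pos_singular_vector hn _ (fun i j => ?_)
    (fun j => Real.cos ((2 * (j : ℕ) + 1) * t)) (fun i => Real.sin ((2 * (i : ℕ) + 2) * t))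
    (fun j => ?_) (by positivity) (fun i => ?_) (fun j => ?_)
  · rw [toeplitzM_one_apply]
    split_ifs <;> norm_num
  · have hj : ((j : ℕ) : ℝ) < n := by exact_mod_cast j.isLt
    refine Real.cos_pos_of_mem_Ioo ⟨?_, ?_⟩
    · have : 0 < (2 * ((j : ℕ) : ℝ) + 1) * t := by positivity
      linarith [Real.pi_pos]
    · rw [← hquarter]
      gcongr
  · rw [sum_toeplitzM_one_row_mul i (fun j => Real.cos ((2 * j + 1) * t)), one_div_mul_eq_div,
      eq_div_iff (by positivity), sum_range_cos_odd_mul]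
    push_cast
    ring_nf
  · rw [sum_toeplitzM_one_col_mul j (fun i => Real.sin ((2 * i + 2) * t)), one_div_mul_eq_div,
      eq_div_iff (by positivity), sum_Ico_sin_even_mul t j.isLt.le, hquarter, Real.cos_pi_div_two,
      sub_zero]
end
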